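/- arXiv:2212.12380 — 10 statements merged into one kernel-verified Lean document; each statement's English description precedes it below -/
import Mathlib

section
/- Proposition 1 in trajectory form, weak monotonicity in the initial condition: let T and T' be the trajectories generated by the recursion from initial conditions T0 and T0' respectively, with the same u, Tout, d. If T0 y ≤ T0' y for every zone y, then T i z ≤ T' i z for every step i : ℕ and every zone z : Fin m. -/
open Finset Matrix

theorem stmt_8 (m : ℕ) (G : SimpleGraph (Fin m)) [DecidableRel G.Adj]
    (b : Fin m → ℝ) (c : Fin m → Fin m → ℝ)
    (hsym : ∀ z y : Fin m, c z y = c y z)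
    (A : Matrix (Fin m) (Fin m) ℝ)
    (hdiag : ∀ z : Fin m, A z z = 1 - b z - ∑ y ∈ G.neighborFinset z, c z y)
    (hadj : ∀ z y : Fin m, G.Adj z y → A z y = c z y)
    (hnadj : ∀ z y : Fin m, z ≠ y → ¬ G.Adj z y → A z y = 0)
    (hb : ∀ z : Fin m, b z + ∑ y ∈ G.neighborFinset z, c z y < 1)
    (hc : ∀ z y : Fin m, G.Adj z y → 0 < c z y)
    (a_h a_c : Fin m → ℝ)
    (u : ℕ → Fin m → ℝ) (Tout : ℕ → ℝ) (d : ℕ → Fin m → ℝ)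
    (T0 : Fin m → ℝ) (T : ℕ → Fin m → ℝ)
    (hT0 : T 0 = T0)
    (hTrec : ∀ k : ℕ, ∀ z : Fin m, T (k+1) z =
      T k z + d k z + a_h z * max (u k z) 0 + a_c z * min (u k z) 0
        - b z * (T k z - Tout k)
        - ∑ y ∈ G.neighborFinset z, c z y * (T k z - T k y))
    (T0' : Fin m → ℝ)
    (T' : ℕ → Fin m → ℝ)
    (hT'0 : T' 0 = T0')
    (hT'rec : ∀ k : ℕ, ∀ z : Fin m, T' (k+1) z =
      T' k z + d k z + a_h z * max (u k z) 0 + a_c z * min (u k z) 0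
        - b z * (T' k z - Tout k)
        - ∑ y ∈ G.neighborFinset z, c z y * (T' k z - T' k y))
    (hle : ∀ y : Fin m, T0 y ≤ T0' y) :
    ∀ (i : ℕ) (z : Fin m), T i z ≤ T' i z := by
  intro i
  induction i with
  | zero => simpa only [hT0, hT'0] using hle
  | succ k ih =>
    intro z
    have hsum : ∑ y ∈ G.neighborFinset z, c z y * T k y ≤
        ∑ y ∈ G.neighborFinset z, c z y * T' k y :=
      Finset.sum_le_sum fun y hy =>
        mul_le_mul_of_nonneg_left (ih y) (hc z y ((G.mem_neighborFinset z y).1 hy)).le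
    have hself := mul_le_mul_of_nonneg_left (ih z) (sub_pos.2 (hb z)).le
    rw [hTrec, hT'rec]
    simp only [mul_sub, Finset.sum_sub_distrib, ← Finset.sum_mul]
    linarith
end

section
/- Proposition 1 in trajectory form, strict part and independence part: fix a zone y : Fin m and let T and T' be the trajectories generated by the recursion from initial conditions T0 and T0' respectively, with the same u, Tout, d, where T0' y > T0 y and T0' w = T0 w for every w ≠ y. Then for every step i : ℕ and every zone z : Fin m: if there exists a walk from z to y in G of length ≤ i then T' i z > T i z, and otherwise T' i z = T i z. In words, a higher initial temperature in zone y strictly raises the temperature of exactly those zones reachable within i steps, and leaves all other zones unaffected. -/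
open Finset Matrix

theorem SimpleGraph.exists_walk_length_le_succ_iff {V : Type*} (G : SimpleGraph V) (z y : V)
    (n : ℕ) :
    (∃ p : G.Walk z y, p.length ≤ n + 1) ↔
      (∃ p : G.Walk z y, p.length ≤ n) ∨
        ∃ w, G.Adj z w ∧ ∃ p : G.Walk w y, p.length ≤ n := by
  constructor
  · rintro ⟨p, hp⟩
    cases p with
    | nil => exact Or.inl ⟨.nil, by simp⟩
    | cons h q => exact Or.inr ⟨_, h, q, by simpa using hp⟩
  · rintro (⟨p, hp⟩ | ⟨w, h, p, hp⟩)
    · exact ⟨p, by omega⟩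
    · exact ⟨.cons h p, by simpa using hp⟩

/-- An impulse at `y`, propagated along the edges of `G` with positive weights, is after `i` steps
positive exactly at the vertices with a walk to `y` of length at most `i`, and zero elsewhere. -/
theorem SimpleGraph.pos_and_eq_zero_of_propagation {V : Type*} [Fintype V] (G : SimpleGraph V)
    [DecidableRel G.Adj] (a : V → ℝ) (c : V → V → ℝ) (ha : ∀ z, 0 < a z)
    (hc : ∀ z w, G.Adj z w → 0 < c z w) (D : ℕ → V → ℝ)
    (hD : ∀ k z, D (k + 1) z = a z * D k z + ∑ w ∈ G.neighborFinset z, c z w * D k w)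
    (y : V) (hy : 0 < D 0 y) (hother : ∀ w, w ≠ y → D 0 w = 0) (i : ℕ) (z : V) :
    ((∃ p : G.Walk z y, p.length ≤ i) → 0 < D i z) ∧
      (¬ (∃ p : G.Walk z y, p.length ≤ i) → D i z = 0) := by
  induction i generalizing z with
  | zero =>
    constructor
    · rintro ⟨p, hp⟩
      rwa [p.eq_of_length_eq_zero (Nat.le_zero.mp hp)]
    · intro h
      refine hother z fun hzy => h ?_
      subst hzy
      exact ⟨.nil, le_rfl⟩
  | succ i ih =>
    have hnonneg : ∀ w, 0 ≤ D i w := fun w => by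
      by_cases h : ∃ p : G.Walk w y, p.length ≤ i
      · exact ((ih w).1 h).le
      · exact ((ih w).2 h).ge
    have hterm : ∀ w ∈ G.neighborFinset z, 0 ≤ c z w * D i w := fun w hw =>
      mul_nonneg (hc z w ((G.mem_neighborFinset z w).1 hw)).le (hnonneg w)
    rw [G.exists_walk_length_le_succ_iff, hD]
    constructor
    · rintro (h | ⟨w, hw, h⟩)
      · exact add_pos_of_pos_of_nonneg (mul_pos (ha z) ((ih z).1 h)) (Finset.sum_nonneg hterm)
      · exact add_pos_of_nonneg_of_pos (mul_nonneg (ha z).le (hnonneg z))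
          (Finset.sum_pos' hterm ⟨w, (G.mem_neighborFinset z w).2 hw,
            mul_pos (hc z w hw) ((ih w).1 h)⟩)
    · intro h
      rw [not_or] at h
      rw [(ih z).2 h.1, mul_zero, zero_add]
      refine Finset.sum_eq_zero fun w hw => ?_
      rw [(ih w).2 fun hp => h.2 ⟨w, (G.mem_neighborFinset z w).1 hw, hp⟩, mul_zero]

theorem stmt_9 (m : ℕ) (G : SimpleGraph (Fin m)) [DecidableRel G.Adj]
    (b : Fin m → ℝ) (c : Fin m → Fin m → ℝ)
    (hsym : ∀ z y : Fin m, c z y = c y z)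
    (A : Matrix (Fin m) (Fin m) ℝ)
    (hdiag : ∀ z : Fin m, A z z = 1 - b z - ∑ y ∈ G.neighborFinset z, c z y)
    (hadj : ∀ z y : Fin m, G.Adj z y → A z y = c z y)
    (hnadj : ∀ z y : Fin m, z ≠ y → ¬ G.Adj z y → A z y = 0)
    (hb : ∀ z : Fin m, b z + ∑ y ∈ G.neighborFinset z, c z y < 1)
    (hc : ∀ z y : Fin m, G.Adj z y → 0 < c z y)
    (a_h a_c : Fin m → ℝ)
    (u : ℕ → Fin m → ℝ) (Tout : ℕ → ℝ) (d : ℕ → Fin m → ℝ)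
    (T0 : Fin m → ℝ) (T : ℕ → Fin m → ℝ)
    (hT0 : T 0 = T0)
    (hTrec : ∀ k : ℕ, ∀ z : Fin m, T (k+1) z =
      T k z + d k z + a_h z * max (u k z) 0 + a_c z * min (u k z) 0
        - b z * (T k z - Tout k)
        - ∑ y ∈ G.neighborFinset z, c z y * (T k z - T k y))
    (y : Fin m) (T0' : Fin m → ℝ)
    (T' : ℕ → Fin m → ℝ)
    (hT'0 : T' 0 = T0')
    (hT'rec : ∀ k : ℕ, ∀ z : Fin m, T' (k+1) z =
      T' k z + d k z + a_h z * max (u k z) 0 + a_c z * min (u k z) 0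
        - b z * (T' k z - Tout k)
        - ∑ y ∈ G.neighborFinset z, c z y * (T' k z - T' k y))
    (hy : T0 y < T0' y)
    (hother : ∀ w : Fin m, w ≠ y → T0' w = T0 w) :
    ∀ (i : ℕ) (z : Fin m),
      ((∃ p : G.Walk z y, p.length ≤ i) → T i z < T' i z) ∧
      (¬ (∃ p : G.Walk z y, p.length ≤ i) → T' i z = T i z) := by
  intro i z
  have key := G.pos_and_eq_zero_of_propagation
    (fun z => 1 - b z - ∑ w ∈ G.neighborFinset z, c z w) c (fun z => by linarith [hb z]) hc
    (fun k z => T' k z - T k z)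
    (fun k z => by
      simp only [hTrec, hT'rec, mul_sub, Finset.sum_sub_distrib, ← Finset.sum_mul]
      ring)
    y (by simpa [hT0, hT'0] using hy)
    (fun w hw => by simp [hT0, hT'0, hother w hw]) i z
  simpa only [sub_pos, sub_eq_zero] using key
end

section
/- Quantified effect of an initial perturbation: fix a zone y : Fin m and δ : ℝ, and let T and T' be the trajectories generated by the recursion from initial conditions T0 and T0' respectively, with the same u, Tout, d, where T0' y = T0 y + δ and T0' w = T0 w for every w ≠ y. Then for every step i : ℕ and every zone z : Fin m, T' i z - T i z = (A ^ i) z y * δ. (This identifies the sensitivity ∂T_{k+i}^z / ∂T_k^y with the matrix entry (A^i)_{zy}.) -/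
open Finset Matrix

/-- A matrix with diagonal entries `1 - b z - ∑ y, c z y`, entries `c z y` on edges and zero elsewhere
acts as one step of the homogeneous zone-coupling recursion. -/
theorem sum_mul_eq_zone_coupling_step {V : Type*} [Fintype V] [DecidableEq V]
    (G : SimpleGraph V) [DecidableRel G.Adj]
    (b : V → ℝ) (c A : V → V → ℝ)
    (hdiag : ∀ z, A z z = 1 - b z - ∑ y ∈ G.neighborFinset z, c z y)
    (hadj : ∀ z y, G.Adj z y → A z y = c z y)
    (hnadj : ∀ z y, z ≠ y → ¬ G.Adj z y → A z y = 0) (v : V → ℝ) (z : V) :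
    ∑ w, A z w * v w =
      v z - b z * v z - ∑ y ∈ G.neighborFinset z, c z y * (v z - v y) := by
  have hsupp : ∑ w, A z w * v w = ∑ w ∈ insert z (G.neighborFinset z), A z w * v w := by
    refine (Finset.sum_subset (Finset.subset_univ _) fun w _ hw => ?_).symm
    rw [Finset.mem_insert, SimpleGraph.mem_neighborFinset, not_or] at hw
    rw [hnadj z w (Ne.symm hw.1) hw.2, zero_mul]
  have hnbr : ∑ w ∈ G.neighborFinset z, A z w * v w = ∑ w ∈ G.neighborFinset z, c z w * v w :=
    Finset.sum_congr rfl fun w hw => by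
      rw [hadj z w ((G.mem_neighborFinset z w).1 hw)]
  rw [hsupp, Finset.sum_insert (by simp), hnbr, hdiag]
  simp only [mul_sub, Finset.sum_sub_distrib, ← Finset.sum_mul]
  ring

theorem stmt_10 (m : ℕ) (G : SimpleGraph (Fin m)) [DecidableRel G.Adj]
    (b : Fin m → ℝ) (c : Fin m → Fin m → ℝ)
    (hsym : ∀ z y : Fin m, c z y = c y z)
    (A : Matrix (Fin m) (Fin m) ℝ)
    (hdiag : ∀ z : Fin m, A z z = 1 - b z - ∑ y ∈ G.neighborFinset z, c z y)
    (hadj : ∀ z y : Fin m, G.Adj z y → A z y = c z y)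
    (hnadj : ∀ z y : Fin m, z ≠ y → ¬ G.Adj z y → A z y = 0)
    (hb : ∀ z : Fin m, b z + ∑ y ∈ G.neighborFinset z, c z y < 1)
    (hc : ∀ z y : Fin m, G.Adj z y → 0 < c z y)
    (a_h a_c : Fin m → ℝ)
    (u : ℕ → Fin m → ℝ) (Tout : ℕ → ℝ) (d : ℕ → Fin m → ℝ)
    (T0 : Fin m → ℝ) (T : ℕ → Fin m → ℝ)
    (hT0 : T 0 = T0)
    (hTrec : ∀ k : ℕ, ∀ z : Fin m, T (k+1) z =
      T k z + d k z + a_h z * max (u k z) 0 + a_c z * min (u k z) 0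
        - b z * (T k z - Tout k)
        - ∑ y ∈ G.neighborFinset z, c z y * (T k z - T k y))
    (y : Fin m) (δ : ℝ) (T0' : Fin m → ℝ)
    (T' : ℕ → Fin m → ℝ)
    (hT'0 : T' 0 = T0')
    (hT'rec : ∀ k : ℕ, ∀ z : Fin m, T' (k+1) z =
      T' k z + d k z + a_h z * max (u k z) 0 + a_c z * min (u k z) 0
        - b z * (T' k z - Tout k)
        - ∑ y ∈ G.neighborFinset z, c z y * (T' k z - T' k y))
    (hy : T0' y = T0 y + δ)
    (hother : ∀ w : Fin m, w ≠ y → T0' w = T0 w) :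
    ∀ (i : ℕ) (z : Fin m), T' i z - T i z = (A ^ i) z y * δ := by
  intro i
  induction i with
  | zero =>
    intro z
    rw [hT0, hT'0, pow_zero]
    by_cases hz : z = y
    · subst hz
      simp [hy]
    · simp [hother z hz, Matrix.one_apply_ne hz]
  | succ i ih =>
    intro z
    have hstep := sum_mul_eq_zone_coupling_step G b c A hdiag hadj hnadj
      (fun w => T' i w - T i w) z
    have hpow : (A ^ (i + 1)) z y * δ = ∑ w, A z w * (T' i w - T i w) := by
      rw [pow_succ', Matrix.mul_apply, Finset.sum_mul]
      exact Finset.sum_congr rfl fun w _ => by rw [ih w, mul_assoc]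
    rw [hpow, hstep, hTrec, hT'rec]
    simp only [mul_sub, Finset.sum_sub_distrib]
    ring
end

section
/- Proposition 2, part (37), weak monotonicity in the power input: fix a zone y : Fin m, a step j : ℕ, and assume a_h y > 0 and a_c y > 0. Let T and T' be the trajectories generated by the recursion from the same initial condition T0 and the same Tout, d, with power input sequences u and u' satisfying u' j y ≥ u j y and u' i w = u i w for all (i, w) ≠ (j, y). Then T' i z ≥ T i z for every step i : ℕ and every zone z : Fin m. -/
open Finset Matrix

/-- The thermal input `a * max u 0 + a' * min u 0` is monotone in the power `u`. -/
theorem thermalInput_mono {a a' u v : ℝ} (ha : 0 ≤ a) (ha' : 0 ≤ a') (huv : u ≤ v) :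
    a * max u 0 + a' * min u 0 ≤ a * max v 0 + a' * min v 0 := by
  gcongr

/-- The heat exchange out of zone `z`, with nonnegative conductances `c`, grows by at most
`∑ c` times the increase at `z` when all temperatures increase. -/
theorem sum_exchange_le {ι : Type*} (s : Finset ι) {c x x' : ι → ℝ} (z : ι)
    (hc : ∀ w ∈ s, 0 ≤ c w) (hx : ∀ w, x w ≤ x' w) :
    ∑ w ∈ s, c w * (x' z - x' w) ≤
      ∑ w ∈ s, c w * (x z - x w) + (∑ w ∈ s, c w) * (x' z - x z) := by
  rw [Finset.sum_mul, ← Finset.sum_add_distrib]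
  refine Finset.sum_le_sum fun w hw => ?_
  linarith [mul_le_mul_of_nonneg_left (hx w) (hc w hw)]

theorem stmt_11 (m : ℕ) (G : SimpleGraph (Fin m)) [DecidableRel G.Adj]
    (b : Fin m → ℝ) (c : Fin m → Fin m → ℝ)
    (hsym : ∀ z y : Fin m, c z y = c y z)
    (A : Matrix (Fin m) (Fin m) ℝ)
    (hdiag : ∀ z : Fin m, A z z = 1 - b z - ∑ y ∈ G.neighborFinset z, c z y)
    (hadj : ∀ z y : Fin m, G.Adj z y → A z y = c z y)
    (hnadj : ∀ z y : Fin m, z ≠ y → ¬ G.Adj z y → A z y = 0)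
    (hb : ∀ z : Fin m, b z + ∑ y ∈ G.neighborFinset z, c z y < 1)
    (hc : ∀ z y : Fin m, G.Adj z y → 0 < c z y)
    (a_h a_c : Fin m → ℝ)
    (u : ℕ → Fin m → ℝ) (Tout : ℕ → ℝ) (d : ℕ → Fin m → ℝ)
    (T0 : Fin m → ℝ) (T : ℕ → Fin m → ℝ)
    (hT0 : T 0 = T0)
    (hTrec : ∀ k : ℕ, ∀ z : Fin m, T (k+1) z =
      T k z + d k z + a_h z * max (u k z) 0 + a_c z * min (u k z) 0
        - b z * (T k z - Tout k)
        - ∑ y ∈ G.neighborFinset z, c z y * (T k z - T k y))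
    (y : Fin m) (j : ℕ)
    (hah : 0 < a_h y) (hac : 0 < a_c y)
    (u' : ℕ → Fin m → ℝ)
    (T' : ℕ → Fin m → ℝ)
    (hT'0 : T' 0 = T0)
    (hT'rec : ∀ k : ℕ, ∀ z : Fin m, T' (k+1) z =
      T' k z + d k z + a_h z * max (u' k z) 0 + a_c z * min (u' k z) 0
        - b z * (T' k z - Tout k)
        - ∑ y ∈ G.neighborFinset z, c z y * (T' k z - T' k y))
    (hu : u j y ≤ u' j y)
    (huother : ∀ (i : ℕ) (w : Fin m), (i, w) ≠ (j, y) → u' i w = u i w) :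
    ∀ (i : ℕ) (z : Fin m), T i z ≤ T' i z := by
  intro i
  induction i with
  | zero => simp [hT0, hT'0]
  | succ k ih =>
    intro z
    have hinput : a_h z * max (u k z) 0 + a_c z * min (u k z) 0 ≤
        a_h z * max (u' k z) 0 + a_c z * min (u' k z) 0 := by
      by_cases h : (k, z) = (j, y)
      · obtain ⟨rfl, rfl⟩ := Prod.mk.inj h
        exact thermalInput_mono hah.le hac.le hu
      · rw [huother k z h]
    have hexchange := sum_exchange_le (G.neighborFinset z) (c := c z) z
      (fun w hw => (hc z w ((G.mem_neighborFinset z w).1 hw)).le) ih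
    have hself := mul_nonneg (sub_nonneg.2 (hb z).le) (sub_nonneg.2 (ih z))
    rw [hTrec, hT'rec]
    linarith
end

section
/- Proposition 2, part (37), strict part and independence part: fix a zone y : Fin m, a step j : ℕ, and assume a_h y > 0 and a_c y > 0. Let T and T' be the trajectories generated by the recursion from the same initial condition T0 and the same Tout, d, with power input sequences u and u' satisfying u' j y > u j y and u' i w = u i w for all (i, w) ≠ (j, y). Then: (a) T' i z = T i z for all i ≤ j and all z; (b) for every i > j and every zone z : Fin m, if there exists a walk from z to y in G of length ≤ i - j - 1 then T' i z > T i z, and otherwise T' i z = T i z. In words, increasing the power input of zone y at step j strictly raises the later temperature of exactly those zones within graph distance i - j - 1 of y. -/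
open Finset Matrix

namespace SimpleGraph

variable {V : Type*} (G : SimpleGraph V)

/-- A walk of length at most `n + 1` is a walk of length at most `n`, possibly preceded by
one step to a neighbour. -/
theorem exists_walk_length_le_succ_iff_s12 {z y : V} {n : ℕ} :
    (∃ p : G.Walk z y, p.length ≤ n + 1) ↔
      (∃ p : G.Walk z y, p.length ≤ n) ∨
        ∃ w, G.Adj z w ∧ ∃ p : G.Walk w y, p.length ≤ n := by
  constructor
  · rintro ⟨p, hp⟩
    cases p with
    | nil => exact Or.inl ⟨.nil, Nat.zero_le n⟩
    | cons h q =>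
      rw [Walk.length_cons] at hp
      exact Or.inr ⟨_, h, q, by omega⟩
  · rintro (⟨p, hp⟩ | ⟨w, h, p, hp⟩)
    · exact ⟨p, by omega⟩
    · exact ⟨.cons h p, by rw [Walk.length_cons]; omega⟩

/-- A perturbation supported at `y` that evolves under a nonnegative linear diffusion with positive
diagonal on a graph is, after `n` steps, positive exactly on the ball of radius `n` about `y`. -/
theorem pos_iff_exists_walk_of_diffusion [G.LocallyFinite] {r : V → ℝ} {c : V → V → ℝ}
    {e : ℕ → V → ℝ} {y : V} (hr : ∀ z, 0 < r z) (hc : ∀ z w, G.Adj z w → 0 < c z w)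
    (he : ∀ n z, e (n + 1) z = r z * e n z + ∑ w ∈ G.neighborFinset z, c z w * e n w)
    (hy : 0 < e 0 y) (hne : ∀ z, z ≠ y → e 0 z = 0) (n : ℕ) (z : V) :
    ((∃ p : G.Walk z y, p.length ≤ n) → 0 < e n z) ∧
      (¬ (∃ p : G.Walk z y, p.length ≤ n) → e n z = 0) := by
  induction n generalizing z with
  | zero =>
    constructor
    · rintro ⟨p, hp⟩
      obtain rfl := p.eq_of_length_eq_zero (Nat.le_zero.mp hp)
      exact hy
    · intro h
      refine hne z ?_
      rintro rfl
      exact h ⟨.nil, le_rfl⟩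
  | succ n ih =>
    have nonneg (w : V) : 0 ≤ e n w := by
      by_cases h : ∃ p : G.Walk w y, p.length ≤ n
      · exact ((ih w).1 h).le
      · exact ((ih w).2 h).ge
    have term_nonneg (w : V) (hw : w ∈ G.neighborFinset z) : 0 ≤ c z w * e n w :=
      mul_nonneg (hc z w ((G.mem_neighborFinset z w).mp hw)).le (nonneg w)
    rw [exists_walk_length_le_succ_iff_s12, he]
    constructor
    · rintro (h | ⟨w, hw, h⟩)
      · exact add_pos_of_pos_of_nonneg (mul_pos (hr z) ((ih z).1 h)) (sum_nonneg term_nonneg)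
      · exact add_pos_of_nonneg_of_pos (mul_nonneg (hr z).le (nonneg z))
          (sum_pos' term_nonneg ⟨w, (G.mem_neighborFinset z w).mpr hw,
            mul_pos (hc z w hw) ((ih w).1 h)⟩)
    · intro h
      push Not at h
      rw [(ih z).2 (by simpa using h.1), mul_zero, zero_add]
      refine sum_eq_zero fun w hw => ?_
      rw [(ih w).2 (by simpa using h.2 w ((G.mem_neighborFinset z w).mp hw)), mul_zero]

end SimpleGraph

/-- The heating and cooling input is strictly increasing in the power. -/
theorem strictMono_mul_max_add_mul_min {p q : ℝ} (hp : 0 < p) (hq : 0 < q) :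
    StrictMono fun x : ℝ => p * max x 0 + q * min x 0 := by
  intro s t hst
  dsimp only
  have hmax : max s 0 ≤ max t 0 := max_le_max_right 0 hst.le
  have hmin : min s 0 ≤ min t 0 := min_le_min_right 0 hst.le
  have hsum : max s 0 + min s 0 < max t 0 + min t 0 := by simpa only [max_add_min, add_zero]
  rcases hmax.lt_or_eq with h | h
  · linarith [mul_lt_mul_of_pos_left h hp, mul_le_mul_of_nonneg_left hmin hq.le]
  · rw [h] at hsum ⊢
    linarith [mul_lt_mul_of_pos_left (lt_of_add_lt_add_left hsum) hq]

theorem stmt_12 (m : ℕ) (G : SimpleGraph (Fin m)) [DecidableRel G.Adj]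
    (b : Fin m → ℝ) (c : Fin m → Fin m → ℝ)
    (hsym : ∀ z y : Fin m, c z y = c y z)
    (A : Matrix (Fin m) (Fin m) ℝ)
    (hdiag : ∀ z : Fin m, A z z = 1 - b z - ∑ y ∈ G.neighborFinset z, c z y)
    (hadj : ∀ z y : Fin m, G.Adj z y → A z y = c z y)
    (hnadj : ∀ z y : Fin m, z ≠ y → ¬ G.Adj z y → A z y = 0)
    (hb : ∀ z : Fin m, b z + ∑ y ∈ G.neighborFinset z, c z y < 1)
    (hc : ∀ z y : Fin m, G.Adj z y → 0 < c z y)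
    (a_h a_c : Fin m → ℝ)
    (u : ℕ → Fin m → ℝ) (Tout : ℕ → ℝ) (d : ℕ → Fin m → ℝ)
    (T0 : Fin m → ℝ) (T : ℕ → Fin m → ℝ)
    (hT0 : T 0 = T0)
    (hTrec : ∀ k : ℕ, ∀ z : Fin m, T (k+1) z =
      T k z + d k z + a_h z * max (u k z) 0 + a_c z * min (u k z) 0
        - b z * (T k z - Tout k)
        - ∑ y ∈ G.neighborFinset z, c z y * (T k z - T k y))
    (y : Fin m) (j : ℕ)
    (hah : 0 < a_h y) (hac : 0 < a_c y)
    (u' : ℕ → Fin m → ℝ)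
    (T' : ℕ → Fin m → ℝ)
    (hT'0 : T' 0 = T0)
    (hT'rec : ∀ k : ℕ, ∀ z : Fin m, T' (k+1) z =
      T' k z + d k z + a_h z * max (u' k z) 0 + a_c z * min (u' k z) 0
        - b z * (T' k z - Tout k)
        - ∑ y ∈ G.neighborFinset z, c z y * (T' k z - T' k y))
    (hu : u j y < u' j y)
    (huother : ∀ (i : ℕ) (w : Fin m), (i, w) ≠ (j, y) → u' i w = u i w) :
    (∀ i : ℕ, i ≤ j → ∀ z : Fin m, T' i z = T i z) ∧
    (∀ i : ℕ, j < i → ∀ z : Fin m,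
      ((∃ p : G.Walk z y, p.length ≤ i - j - 1) → T i z < T' i z) ∧
      (¬ (∃ p : G.Walk z y, p.length ≤ i - j - 1) → T' i z = T i z)) := by
  have before : ∀ i ≤ j, ∀ z, T' i z = T i z := by
    intro i
    induction i with
    | zero => simp [hT0, hT'0]
    | succ i ih =>
      intro hi z
      have hw : ∀ w, T' i w = T i w := ih (by omega)
      have hui : u' i z = u i z := huother i z fun h => by
        have := congrArg Prod.fst h
        dsimp only at this
        omega
      simp only [hT'rec, hTrec, hw, hui]
  have at_impulse (z : Fin m) : T' (j + 1) z - T (j + 1) z =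
      (a_h z * max (u' j z) 0 + a_c z * min (u' j z) 0) -
        (a_h z * max (u j z) 0 + a_c z * min (u j z) 0) := by
    simp only [hT'rec, hTrec, before j le_rfl]
    ring
  have diffusion (n : ℕ) (z : Fin m) :
      T' (j + 1 + (n + 1)) z - T (j + 1 + (n + 1)) z =
        (1 - b z - ∑ w ∈ G.neighborFinset z, c z w) * (T' (j + 1 + n) z - T (j + 1 + n) z) +
          ∑ w ∈ G.neighborFinset z, c z w * (T' (j + 1 + n) w - T (j + 1 + n) w) := by
    have hui : u' (j + 1 + n) z = u (j + 1 + n) z := huother _ z fun h => by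
      have := congrArg Prod.fst h
      dsimp only at this
      omega
    rw [← add_assoc, hT'rec, hTrec, hui]
    simp only [mul_sub, sum_sub_distrib, ← sum_mul]
    ring
  refine ⟨before, fun i hi z => ?_⟩
  obtain ⟨n, rfl⟩ := Nat.exists_eq_add_of_le (Nat.succ_le_of_lt hi)
  have key := G.pos_iff_exists_walk_of_diffusion
    (e := fun n z => T' (j + 1 + n) z - T (j + 1 + n) z)
    (fun z => by linarith [hb z]) hc diffusion
    (by
      simp only [add_zero, at_impulse, sub_pos]
      exact strictMono_mul_max_add_mul_min hah hac hu)
    (fun z hz => by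
      have hui : u' j z = u j z := huother j z fun h => hz (congrArg Prod.snd h)
      simp only [add_zero, at_impulse, hui, sub_self])
    n z
  have hn : j + 1 + n - j - 1 = n := by omega
  simpa only [Nat.succ_eq_add_one, hn, sub_pos, sub_eq_zero] using key
end

section
/- Quantified effect of a power-input perturbation: fix a zone y : Fin m and a step j : ℕ, and let T and T' be the trajectories generated by the recursion from the same initial condition T0 and the same Tout, d, with power inputs u and u' satisfying u' i w = u i w for all (i, w) ≠ (j, y). Define h : ℝ → ℝ by h v = a_h y * max v 0 + a_c y * min v 0. Then for every i > j and every zone z : Fin m, T' i z - T i z = (A ^ (i - j - 1)) z y * (h (u' j y) - h (u j y)). (This identifies the sensitivity of T_{k+i}^z to the power input u_{k+j}^y.) -/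
open Finset Matrix

/-- A matrix supported on the diagonal and the edges of `G`, with diagonal `1 - b - ∑ c`, acts as
the identity minus the loss `b` minus the weighted graph Laplacian. -/
theorem mulVec_apply_eq_sub_sum_neighborFinset {V R : Type*} [Fintype V] [DecidableEq V]
    [CommRing R] (G : SimpleGraph V) [DecidableRel G.Adj] {b : V → R} {c : V → V → R}
    {A : Matrix V V R}
    (hdiag : ∀ z, A z z = 1 - b z - ∑ y ∈ G.neighborFinset z, c z y)
    (hadj : ∀ z y, G.Adj z y → A z y = c z y)
    (hnadj : ∀ z y, z ≠ y → ¬ G.Adj z y → A z y = 0) (x : V → R) (z : V) :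
    (A *ᵥ x) z = x z - b z * x z - ∑ y ∈ G.neighborFinset z, c z y * (x z - x y) := by
  have hentry (y : V) : A z y * x y = (if z = y then A z z * x z else 0) +
      if y ∈ G.neighborFinset z then c z y * x y else 0 := by
    rcases eq_or_ne z y with rfl | hne
    · simp
    · by_cases hzy : G.Adj z y
      · simp [hne, hzy, hadj z y hzy]
      · simp [hne, hzy, hnadj z y hne hzy]
  simp only [mulVec, dotProduct, hentry, sum_add_distrib, sum_ite_eq, mem_univ, if_true,
    sum_ite_mem, univ_inter, hdiag, mul_sub, sum_sub_distrib, ← sum_mul]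
  ring

/-- A perturbation entering a linear recursion once, at step `j`, is propagated by powers of the
matrix. -/
theorem eq_pow_mulVec_of_forcing_single {V R : Type*} [Fintype V] [DecidableEq V] [CommRing R]
    {A : Matrix V V R} {e f : ℕ → V → R} {j : ℕ} (h0 : e 0 = 0)
    (hrec : ∀ k, e (k + 1) = A *ᵥ e k + f k) (hf : ∀ k, k ≠ j → f k = 0) (n : ℕ) :
    e (j + 1 + n) = (A ^ n) *ᵥ f j := by
  have hzero : ∀ k ≤ j, e k = 0 := by
    intro k hk
    induction k with
    | zero => exact h0
    | succ k ih => rw [hrec, ih (by omega), hf k (by omega), mulVec_zero, add_zero]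
  induction n with
  | zero => simp [hrec, hzero j le_rfl]
  | succ n ih => rw [← add_assoc, hrec, ih, hf (j + 1 + n) (by omega), add_zero, mulVec_mulVec, pow_succ']

theorem stmt_13 (m : ℕ) (G : SimpleGraph (Fin m)) [DecidableRel G.Adj]
    (b : Fin m → ℝ) (c : Fin m → Fin m → ℝ)
    (hsym : ∀ z y : Fin m, c z y = c y z)
    (A : Matrix (Fin m) (Fin m) ℝ)
    (hdiag : ∀ z : Fin m, A z z = 1 - b z - ∑ y ∈ G.neighborFinset z, c z y)
    (hadj : ∀ z y : Fin m, G.Adj z y → A z y = c z y)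
    (hnadj : ∀ z y : Fin m, z ≠ y → ¬ G.Adj z y → A z y = 0)
    (hb : ∀ z : Fin m, b z + ∑ y ∈ G.neighborFinset z, c z y < 1)
    (hc : ∀ z y : Fin m, G.Adj z y → 0 < c z y)
    (a_h a_c : Fin m → ℝ)
    (u : ℕ → Fin m → ℝ) (Tout : ℕ → ℝ) (d : ℕ → Fin m → ℝ)
    (T0 : Fin m → ℝ) (T : ℕ → Fin m → ℝ)
    (hT0 : T 0 = T0)
    (hTrec : ∀ k : ℕ, ∀ z : Fin m, T (k+1) z =
      T k z + d k z + a_h z * max (u k z) 0 + a_c z * min (u k z) 0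
        - b z * (T k z - Tout k)
        - ∑ y ∈ G.neighborFinset z, c z y * (T k z - T k y))
    (y : Fin m) (j : ℕ)
    (u' : ℕ → Fin m → ℝ)
    (T' : ℕ → Fin m → ℝ)
    (hT'0 : T' 0 = T0)
    (hT'rec : ∀ k : ℕ, ∀ z : Fin m, T' (k+1) z =
      T' k z + d k z + a_h z * max (u' k z) 0 + a_c z * min (u' k z) 0
        - b z * (T' k z - Tout k)
        - ∑ y ∈ G.neighborFinset z, c z y * (T' k z - T' k y))
    (huother : ∀ (i : ℕ) (w : Fin m), (i, w) ≠ (j, y) → u' i w = u i w)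
    (h : ℝ → ℝ)
    (hh : ∀ v : ℝ, h v = a_h y * max v 0 + a_c y * min v 0) :
    ∀ i : ℕ, j < i → ∀ z : Fin m,
      T' i z - T i z = (A ^ (i - j - 1)) z y * (h (u' j y) - h (u j y)) := by
  intro i hi z
  set g : ℕ → Fin m → ℝ := fun k w =>
    (a_h w * max (u' k w) 0 + a_c w * min (u' k w) 0) -
      (a_h w * max (u k w) 0 + a_c w * min (u k w) 0) with hg
  have hrec (k : ℕ) : T' (k + 1) - T (k + 1) = A *ᵥ (T' k - T k) + g k := by
    ext w
    simp only [Pi.sub_apply, Pi.add_apply, hT'rec, hTrec, hg,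
      mulVec_apply_eq_sub_sum_neighborFinset G hdiag hadj hnadj, mul_sub, sum_sub_distrib]
    ring
  have hgzero (k : ℕ) (hk : k ≠ j) : g k = 0 := by
    ext w
    simp [hg, huother k w (by simp [hk])]
  have hgj : g j = Pi.single y (h (u' j y) - h (u j y)) := by
    ext w
    rcases eq_or_ne w y with rfl | hw
    · simp [hg, hh]
    · simp [hg, hw, huother j w (by simp [hw])]
  have key := eq_pow_mulVec_of_forcing_single (e := fun k => T' k - T k)
    (by simp [hT0, hT'0]) hrec hgzero (i - j - 1)
  rw [show j + 1 + (i - j - 1) = i by omega, hgj] at key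
  simpa [mulVec_single, mul_comm] using congrFun key z
end

section
/- Proposition 2, part (38), strict monotonicity in the outside temperature: fix a step j : ℕ and assume b z > 0 for every zone z. Let T and T' be the trajectories generated by the recursion from the same initial condition T0, the same u and d, with outside temperature sequences Tout and Tout' satisfying Tout' j > Tout j and Tout' i = Tout i for all i ≠ j. Then T' i z = T i z for all i ≤ j and all z, and T' i z > T i z for every i > j and every zone z : Fin m. In words, a higher outside temperature at step j strictly raises the temperature of every zone of the building at all later steps. -/
open Finset Matrix

/-- The one-step error propagation of two thermal updates driven by the same inputs but with
different current temperatures `t`, `t'` and outside temperatures `o`, `o'`. -/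
theorem thermal_step_sub {ι : Type*} (s : Finset ι) (c t t' : ι → ℝ) (β x x' o o' q : ℝ) :
    (x' + q - β * (x' - o') - ∑ y ∈ s, c y * (x' - t' y)) -
      (x + q - β * (x - o) - ∑ y ∈ s, c y * (x - t y)) =
    (1 - β - ∑ y ∈ s, c y) * (x' - x) + β * (o' - o) + ∑ y ∈ s, c y * (t' y - t y) := by
  simp only [mul_sub, Finset.sum_sub_distrib, ← Finset.sum_mul]
  ring

theorem stmt_14 (m : ℕ) (G : SimpleGraph (Fin m)) [DecidableRel G.Adj]
    (b : Fin m → ℝ) (c : Fin m → Fin m → ℝ)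
    (hsym : ∀ z y : Fin m, c z y = c y z)
    (A : Matrix (Fin m) (Fin m) ℝ)
    (hdiag : ∀ z : Fin m, A z z = 1 - b z - ∑ y ∈ G.neighborFinset z, c z y)
    (hadj : ∀ z y : Fin m, G.Adj z y → A z y = c z y)
    (hnadj : ∀ z y : Fin m, z ≠ y → ¬ G.Adj z y → A z y = 0)
    (hb : ∀ z : Fin m, b z + ∑ y ∈ G.neighborFinset z, c z y < 1)
    (hc : ∀ z y : Fin m, G.Adj z y → 0 < c z y)
    (a_h a_c : Fin m → ℝ)
    (u : ℕ → Fin m → ℝ) (Tout : ℕ → ℝ) (d : ℕ → Fin m → ℝ)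
    (T0 : Fin m → ℝ) (T : ℕ → Fin m → ℝ)
    (hT0 : T 0 = T0)
    (hTrec : ∀ k : ℕ, ∀ z : Fin m, T (k+1) z =
      T k z + d k z + a_h z * max (u k z) 0 + a_c z * min (u k z) 0
        - b z * (T k z - Tout k)
        - ∑ y ∈ G.neighborFinset z, c z y * (T k z - T k y))
    (j : ℕ) (hbpos : ∀ z : Fin m, 0 < b z)
    (Tout' : ℕ → ℝ)
    (T' : ℕ → Fin m → ℝ)
    (hT'0 : T' 0 = T0)
    (hT'rec : ∀ k : ℕ, ∀ z : Fin m, T' (k+1) z =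
      T' k z + d k z + a_h z * max (u k z) 0 + a_c z * min (u k z) 0
        - b z * (T' k z - Tout' k)
        - ∑ y ∈ G.neighborFinset z, c z y * (T' k z - T' k y))
    (hTo : Tout j < Tout' j)
    (hToother : ∀ i : ℕ, i ≠ j → Tout' i = Tout i) :
    (∀ i : ℕ, i ≤ j → ∀ z : Fin m, T' i z = T i z) ∧
    (∀ i : ℕ, j < i → ∀ z : Fin m, T i z < T' i z) := by
  have hstep : ∀ k z, T' (k+1) z - T (k+1) z =
      (1 - b z - ∑ y ∈ G.neighborFinset z, c z y) * (T' k z - T k z)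
        + b z * (Tout' k - Tout k)
        + ∑ y ∈ G.neighborFinset z, c z y * (T' k y - T k y) := by
    intro k z
    rw [hTrec, hT'rec, ← thermal_step_sub _ _ _ _ _ _ _ _ _
      (d k z + a_h z * max (u k z) 0 + a_c z * min (u k z) 0)]
    ring
  have heq : ∀ i, i ≤ j → ∀ z, T' i z = T i z := by
    intro i
    induction i with
    | zero => simp [hT0, hT'0]
    | succ k ih =>
      intro hk z
      have hz := hstep k z
      simp only [ih (by omega), hToother k (by omega), sub_self, mul_zero,
        Finset.sum_const_zero, add_zero] at hz
      exact sub_eq_zero.mp hz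
  refine ⟨heq, fun i hi => ?_⟩
  induction i, hi using Nat.le_induction with
  | base =>
    intro z
    have hz := hstep j z
    simp only [heq j le_rfl, sub_self, mul_zero, Finset.sum_const_zero, add_zero, zero_add] at hz
    exact sub_pos.mp (hz ▸ mul_pos (hbpos z) (sub_pos.mpr hTo))
  | succ k hk ih =>
    intro z
    have hz := hstep k z
    rw [hToother k (by omega), sub_self, mul_zero, add_zero] at hz
    have hself : 0 < (1 - b z - ∑ y ∈ G.neighborFinset z, c z y) * (T' k z - T k z) :=
      mul_pos (by linarith [hb z]) (sub_pos.mpr (ih z))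
    have hnbr : 0 ≤ ∑ y ∈ G.neighborFinset z, c z y * (T' k y - T k y) :=
      Finset.sum_nonneg fun y hy =>
        mul_nonneg (hc z y ((G.mem_neighborFinset z y).mp hy)).le (sub_pos.mpr (ih y)).le
    linarith
end

section
/- Quantified effect of an outside-temperature perturbation: fix a step j : ℕ and δ : ℝ, and let T and T' be the trajectories generated by the recursion from the same initial condition T0, the same u and d, with outside temperature sequences Tout and Tout' satisfying Tout' j = Tout j + δ and Tout' i = Tout i for all i ≠ j. Then for every i > j and every zone z : Fin m, T' i z - T i z = δ * ∑_{y : Fin m} (A ^ (i - j - 1)) z y * b y. -/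
open Finset Matrix

/-- A matrix with the heat-exchange pattern of `G` acts as one step of the linear dynamics. -/
theorem mulVec_eq_sub_sum_neighborFinset {V : Type*} [Fintype V] [DecidableEq V]
    (G : SimpleGraph V) [DecidableRel G.Adj] (b : V → ℝ) (c : V → V → ℝ) (A : Matrix V V ℝ)
    (hdiag : ∀ z, A z z = 1 - b z - ∑ y ∈ G.neighborFinset z, c z y)
    (hadj : ∀ z y, G.Adj z y → A z y = c z y)
    (hnadj : ∀ z y, z ≠ y → ¬ G.Adj z y → A z y = 0) (x : V → ℝ) (z : V) :
    (A *ᵥ x) z = x z - b z * x z - ∑ y ∈ G.neighborFinset z, c z y * (x z - x y) := by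
  have hsupp : ∑ y, A z y * x y = ∑ y ∈ insert z (G.neighborFinset z), A z y * x y := by
    refine (Finset.sum_subset (Finset.subset_univ _) fun y _ hy => ?_).symm
    simp only [Finset.mem_insert, SimpleGraph.mem_neighborFinset, not_or] at hy
    rw [hnadj z y (Ne.symm hy.1) hy.2, zero_mul]
  have hnbr : ∑ y ∈ G.neighborFinset z, A z y * x y = ∑ y ∈ G.neighborFinset z, c z y * x y :=
    Finset.sum_congr rfl fun y hy => by rw [hadj z y ((G.mem_neighborFinset z y).1 hy)]
  simp only [Matrix.mulVec, dotProduct]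
  rw [hsupp, Finset.sum_insert (by simp), hnbr, hdiag]
  simp only [mul_sub, Finset.sum_sub_distrib, ← Finset.sum_mul]
  ring

/-- The response of a linear recursion started at zero to a single impulse `v` at time `j`. -/
theorem eq_pow_mulVec_of_impulse {V R : Type*} [Fintype V] [DecidableEq V] [Semiring R]
    (A : Matrix V V R) (e : ℕ → V → R) (v : V → R) (j : ℕ) (h0 : e 0 = 0)
    (hj : e (j + 1) = A *ᵥ e j + v) (hne : ∀ k, k ≠ j → e (k + 1) = A *ᵥ e k) (n : ℕ) :
    e (j + 1 + n) = (A ^ n) *ᵥ v := by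
  have hzero : ∀ k ≤ j, e k = 0 := by
    intro k
    induction k with
    | zero => exact fun _ => h0
    | succ k ih => intro hk; rw [hne k (by omega), ih (by omega), Matrix.mulVec_zero]
  induction n with
  | zero => simp [hj, hzero j le_rfl]
  | succ n ih =>
    rw [← Nat.add_assoc, hne _ (by omega), ih, Matrix.mulVec_mulVec, ← pow_succ']

theorem stmt_15 (m : ℕ) (G : SimpleGraph (Fin m)) [DecidableRel G.Adj]
    (b : Fin m → ℝ) (c : Fin m → Fin m → ℝ)
    (hsym : ∀ z y : Fin m, c z y = c y z)
    (A : Matrix (Fin m) (Fin m) ℝ)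
    (hdiag : ∀ z : Fin m, A z z = 1 - b z - ∑ y ∈ G.neighborFinset z, c z y)
    (hadj : ∀ z y : Fin m, G.Adj z y → A z y = c z y)
    (hnadj : ∀ z y : Fin m, z ≠ y → ¬ G.Adj z y → A z y = 0)
    (hb : ∀ z : Fin m, b z + ∑ y ∈ G.neighborFinset z, c z y < 1)
    (hc : ∀ z y : Fin m, G.Adj z y → 0 < c z y)
    (a_h a_c : Fin m → ℝ)
    (u : ℕ → Fin m → ℝ) (Tout : ℕ → ℝ) (d : ℕ → Fin m → ℝ)
    (T0 : Fin m → ℝ) (T : ℕ → Fin m → ℝ)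
    (hT0 : T 0 = T0)
    (hTrec : ∀ k : ℕ, ∀ z : Fin m, T (k+1) z =
      T k z + d k z + a_h z * max (u k z) 0 + a_c z * min (u k z) 0
        - b z * (T k z - Tout k)
        - ∑ y ∈ G.neighborFinset z, c z y * (T k z - T k y))
    (j : ℕ) (δ : ℝ)
    (Tout' : ℕ → ℝ)
    (T' : ℕ → Fin m → ℝ)
    (hT'0 : T' 0 = T0)
    (hT'rec : ∀ k : ℕ, ∀ z : Fin m, T' (k+1) z =
      T' k z + d k z + a_h z * max (u k z) 0 + a_c z * min (u k z) 0
        - b z * (T' k z - Tout' k)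
        - ∑ y ∈ G.neighborFinset z, c z y * (T' k z - T' k y))
    (hTo : Tout' j = Tout j + δ)
    (hToother : ∀ i : ℕ, i ≠ j → Tout' i = Tout i) :
    ∀ i : ℕ, j < i → ∀ z : Fin m,
      T' i z - T i z = δ * ∑ y : Fin m, (A ^ (i - j - 1)) z y * b y := by
  have hstep : ∀ k, T' (k + 1) - T (k + 1) =
      A *ᵥ (T' k - T k) + fun z => b z * (Tout' k - Tout k) := by
    intro k
    ext z
    have hsum : ∑ y ∈ G.neighborFinset z, c z y * ((T' k - T k) z - (T' k - T k) y) =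
        ∑ y ∈ G.neighborFinset z, c z y * (T' k z - T' k y) -
          ∑ y ∈ G.neighborFinset z, c z y * (T k z - T k y) := by
      rw [← Finset.sum_sub_distrib]
      exact Finset.sum_congr rfl fun y _ => by simp only [Pi.sub_apply]; ring
    rw [Pi.add_apply, mulVec_eq_sub_sum_neighborFinset G b c A hdiag hadj hnadj, hsum,
      Pi.sub_apply, Pi.sub_apply, hTrec, hT'rec]
    ring
  intro i hi z
  obtain ⟨n, rfl⟩ := Nat.exists_eq_add_of_lt hi
  have himpulse := eq_pow_mulVec_of_impulse A (fun k => T' k - T k) (δ • b) j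
    (by simp [hT0, hT'0])
    (by
      refine (hstep j).trans ?_
      congr 1
      ext y
      simp [hTo, mul_comm])
    (fun k hk => by
      refine (hstep k).trans ?_
      ext y
      simp [hToother k hk]) n
  have hz := congrFun himpulse z
  rw [Matrix.mulVec_smul] at hz
  rw [show j + n + 1 - j - 1 = n by omega, show j + n + 1 = j + 1 + n by omega]
  exact hz
end

section
/- Corollary (physical consistency of PCNNs), input consistency: fix a zone z : Fin m and a step j : ℕ, and assume a_h z > 0 and a_c z > 0. Let T and T' be the trajectories generated by the recursion from the same initial condition T0 and the same Tout, d, with power inputs u and u' satisfying u' j z > u j z and u' i w = u i w for all (i, w) ≠ (j, z). Then T' i z > T i z for every i > j. In words, strictly increasing the heating (or decreasing the cooling) power in a zone strictly increases that zone's own temperature at all later steps. -/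
open Finset Matrix

/-- Heat exchange with the neighbours, written as a linear form in the temperatures. -/
theorem diffusion_eq {V : Type*} (s : Finset V) (β : ℝ) (γ x : V → ℝ) (w : V) :
    x w - β * x w - ∑ y ∈ s, γ y * (x w - x y) =
      (1 - β - ∑ y ∈ s, γ y) * x w + ∑ y ∈ s, γ y * x y := by
  simp only [mul_sub, Finset.sum_sub_distrib, ← Finset.sum_mul]
  ring

theorem diffusion_mono {V : Type*} {s : Finset V} {β : ℝ} {γ x x' : V → ℝ} {w : V}
    (hβ : β + ∑ y ∈ s, γ y < 1) (hγ : ∀ y ∈ s, 0 < γ y) (hx : x ≤ x') :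
    x w - β * x w - ∑ y ∈ s, γ y * (x w - x y) ≤
      x' w - β * x' w - ∑ y ∈ s, γ y * (x' w - x' y) := by
  rw [diffusion_eq, diffusion_eq]
  exact add_le_add (mul_le_mul_of_nonneg_left (hx w) (by linarith))
    (Finset.sum_le_sum fun y hy => mul_le_mul_of_nonneg_left (hx y) (hγ y hy).le)

theorem diffusion_strictMono {V : Type*} {s : Finset V} {β : ℝ} {γ x x' : V → ℝ} {w : V}
    (hβ : β + ∑ y ∈ s, γ y < 1) (hγ : ∀ y ∈ s, 0 < γ y) (hx : x ≤ x') (hw : x w < x' w) :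
    x w - β * x w - ∑ y ∈ s, γ y * (x w - x y) <
      x' w - β * x' w - ∑ y ∈ s, γ y * (x' w - x' y) := by
  rw [diffusion_eq, diffusion_eq]
  exact add_lt_add_of_lt_of_le (mul_lt_mul_of_pos_left hw (by linarith))
    (Finset.sum_le_sum fun y hy => mul_le_mul_of_nonneg_left (hx y) (hγ y hy).le)

/-- The heating/cooling power law is strictly increasing when both efficiencies are positive. -/
theorem heating_cooling_strictMono {α κ : ℝ} (hα : 0 < α) (hκ : 0 < κ) :
    StrictMono fun p : ℝ => α * max p 0 + κ * min p 0 := by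
  intro p q hpq
  rcases le_or_gt q 0 with hq | hq
  · simp only [max_eq_right hq, max_eq_right (hpq.le.trans hq), min_eq_left hq,
      min_eq_left (hpq.le.trans hq)]
    linarith [mul_lt_mul_of_pos_left hpq hκ]
  · have hmax : max p 0 < max q 0 := by
      rw [max_eq_left hq.le]
      exact max_lt hpq hq
    exact add_lt_add_of_lt_of_le (mul_lt_mul_of_pos_left hmax hα)
      (mul_le_mul_of_nonneg_left (min_le_min_right 0 hpq.le) hκ.le)

theorem stmt_16 (m : ℕ) (G : SimpleGraph (Fin m)) [DecidableRel G.Adj]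
    (b : Fin m → ℝ) (c : Fin m → Fin m → ℝ)
    (hsym : ∀ z y : Fin m, c z y = c y z)
    (A : Matrix (Fin m) (Fin m) ℝ)
    (hdiag : ∀ z : Fin m, A z z = 1 - b z - ∑ y ∈ G.neighborFinset z, c z y)
    (hadj : ∀ z y : Fin m, G.Adj z y → A z y = c z y)
    (hnadj : ∀ z y : Fin m, z ≠ y → ¬ G.Adj z y → A z y = 0)
    (hb : ∀ z : Fin m, b z + ∑ y ∈ G.neighborFinset z, c z y < 1)
    (hc : ∀ z y : Fin m, G.Adj z y → 0 < c z y)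
    (a_h a_c : Fin m → ℝ)
    (u : ℕ → Fin m → ℝ) (Tout : ℕ → ℝ) (d : ℕ → Fin m → ℝ)
    (T0 : Fin m → ℝ) (T : ℕ → Fin m → ℝ)
    (hT0 : T 0 = T0)
    (hTrec : ∀ k : ℕ, ∀ z : Fin m, T (k+1) z =
      T k z + d k z + a_h z * max (u k z) 0 + a_c z * min (u k z) 0
        - b z * (T k z - Tout k)
        - ∑ y ∈ G.neighborFinset z, c z y * (T k z - T k y))
    (z : Fin m) (j : ℕ)
    (hah : 0 < a_h z) (hac : 0 < a_c z)
    (u' : ℕ → Fin m → ℝ)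
    (T' : ℕ → Fin m → ℝ)
    (hT'0 : T' 0 = T0)
    (hT'rec : ∀ k : ℕ, ∀ z : Fin m, T' (k+1) z =
      T' k z + d k z + a_h z * max (u' k z) 0 + a_c z * min (u' k z) 0
        - b z * (T' k z - Tout k)
        - ∑ y ∈ G.neighborFinset z, c z y * (T' k z - T' k y))
    (hu : u j z < u' j z)
    (huother : ∀ (i : ℕ) (w : Fin m), (i, w) ≠ (j, z) → u' i w = u i w) :
    ∀ i : ℕ, j < i → T i z < T' i z := by
  have hγ : ∀ w, ∀ y ∈ G.neighborFinset w, 0 < c w y := fun w y hy =>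
    hc w y ((G.mem_neighborFinset w y).1 hy)
  have hpower : a_h z * max (u j z) 0 + a_c z * min (u j z) 0 <
      a_h z * max (u' j z) 0 + a_c z * min (u' j z) 0 :=
    heating_cooling_strictMono hah hac hu
  have hle : ∀ k, T k ≤ T' k := by
    intro k
    induction k with
    | zero => rw [hT0, hT'0]
    | succ k ih =>
      intro w
      have hmono := diffusion_mono (w := w) (hb w) (hγ w) ih
      rw [hTrec, hT'rec]
      by_cases hkw : (k, w) = (j, z)
      · obtain ⟨rfl, rfl⟩ := Prod.mk.inj hkw
        linarith [hpower]
      · rw [huother k w hkw]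
        linarith
  intro i hi
  induction i, hi using Nat.le_induction with
  | base =>
    have hmono := diffusion_mono (w := z) (hb z) (hγ z) (hle j)
    rw [hTrec, hT'rec]
    linarith [hpower]
  | succ k hk ih =>
    have hmono := diffusion_strictMono (hb z) (hγ z) (hle k) ih
    have hkj : (k, z) ≠ (j, z) := fun h => (Nat.lt_of_succ_le hk).ne' (Prod.mk.inj h).1
    rw [hTrec, hT'rec, huother k z hkj]
    linarith
end

section
/- Corollary (physical consistency of PCNNs), neighbor consistency: fix adjacent zones z y : Fin m with G.Adj z y, and let T and T' be the trajectories generated by the recursion from initial conditions T0 and T0' respectively, with the same u, Tout, d, where T0' y > T0 y and T0' w = T0 w for every w ≠ y. Then T' i z > T i z for every step i ≥ 1. In words, a strictly higher temperature in a zone strictly raises the temperature of every adjacent zone at all later steps. -/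
open Finset Matrix

/-- The difference of two trajectories of the heat-exchange recursion driven by the same inputs
evolves linearly. -/
theorem trajectory_sub_succ {V : Type*} (G : SimpleGraph V) [G.LocallyFinite]
    (b : V → ℝ) (c : V → V → ℝ) (f : ℕ → V → ℝ) (Tout : ℕ → ℝ) (T T' : ℕ → V → ℝ)
    (hT : ∀ k z, T (k + 1) z = T k z + f k z - b z * (T k z - Tout k)
      - ∑ y ∈ G.neighborFinset z, c z y * (T k z - T k y))
    (hT' : ∀ k z, T' (k + 1) z = T' k z + f k z - b z * (T' k z - Tout k)
      - ∑ y ∈ G.neighborFinset z, c z y * (T' k z - T' k y)) (k : ℕ) (z : V) :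
    T' (k + 1) z - T (k + 1) z =
      (1 - (b z + ∑ y ∈ G.neighborFinset z, c z y)) * (T' k z - T k z)
        + ∑ y ∈ G.neighborFinset z, c z y * (T' k y - T k y) := by
  rw [hT, hT']
  simp only [mul_sub, Finset.sum_sub_distrib, ← Finset.sum_mul]
  ring

theorem stmt_17 (m : ℕ) (G : SimpleGraph (Fin m)) [DecidableRel G.Adj]
    (b : Fin m → ℝ) (c : Fin m → Fin m → ℝ)
    (hsym : ∀ z y : Fin m, c z y = c y z)
    (A : Matrix (Fin m) (Fin m) ℝ)
    (hdiag : ∀ z : Fin m, A z z = 1 - b z - ∑ y ∈ G.neighborFinset z, c z y)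
    (hadj : ∀ z y : Fin m, G.Adj z y → A z y = c z y)
    (hnadj : ∀ z y : Fin m, z ≠ y → ¬ G.Adj z y → A z y = 0)
    (hb : ∀ z : Fin m, b z + ∑ y ∈ G.neighborFinset z, c z y < 1)
    (hc : ∀ z y : Fin m, G.Adj z y → 0 < c z y)
    (a_h a_c : Fin m → ℝ)
    (u : ℕ → Fin m → ℝ) (Tout : ℕ → ℝ) (d : ℕ → Fin m → ℝ)
    (T0 : Fin m → ℝ) (T : ℕ → Fin m → ℝ)
    (hT0 : T 0 = T0)
    (hTrec : ∀ k : ℕ, ∀ z : Fin m, T (k+1) z =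
      T k z + d k z + a_h z * max (u k z) 0 + a_c z * min (u k z) 0
        - b z * (T k z - Tout k)
        - ∑ y ∈ G.neighborFinset z, c z y * (T k z - T k y))
    (z y : Fin m) (hzy : G.Adj z y)
    (T0' : Fin m → ℝ)
    (T' : ℕ → Fin m → ℝ)
    (hT'0 : T' 0 = T0')
    (hT'rec : ∀ k : ℕ, ∀ z : Fin m, T' (k+1) z =
      T' k z + d k z + a_h z * max (u k z) 0 + a_c z * min (u k z) 0
        - b z * (T' k z - Tout k)
        - ∑ y ∈ G.neighborFinset z, c z y * (T' k z - T' k y))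
    (hy : T0 y < T0' y)
    (hother : ∀ w : Fin m, w ≠ y → T0' w = T0 w) :
    ∀ i : ℕ, 1 ≤ i → T i z < T' i z := by
  have step := trajectory_sub_succ G b c
    (fun k z => d k z + a_h z * max (u k z) 0 + a_c z * min (u k z) 0) Tout T T'
    (fun k z => by rw [hTrec]; ring) (fun k z => by rw [hT'rec]; ring)
  have exchange_nonneg {k : ℕ} (h : ∀ w, 0 ≤ T' k w - T k w) (w : Fin m) :
      ∀ v ∈ G.neighborFinset w, 0 ≤ c w v * (T' k v - T k v) := fun v hv =>
    mul_nonneg (hc w v ((G.mem_neighborFinset w v).1 hv)).le (h v)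
  have key (k : ℕ) : (∀ w, 0 ≤ T' k w - T k w) ∧ 0 < T' k y - T k y := by
    induction k with
    | zero =>
      rw [hT0, hT'0]
      refine ⟨fun w => ?_, sub_pos.2 hy⟩
      obtain rfl | hw := eq_or_ne w y
      · exact (sub_pos.2 hy).le
      · rw [hother w hw, sub_self]
    | succ k ih =>
      refine ⟨fun w => ?_, ?_⟩
      · rw [step]
        exact add_nonneg (mul_nonneg (sub_pos.2 (hb w)).le (ih.1 w))
          (Finset.sum_nonneg (exchange_nonneg ih.1 w))
      · rw [step]
        exact add_pos_of_pos_of_nonneg (mul_pos (sub_pos.2 (hb y)) ih.2)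
          (Finset.sum_nonneg (exchange_nonneg ih.1 y))
  intro i hi
  obtain ⟨k, rfl⟩ := Nat.exists_eq_add_of_le' hi
  rw [← sub_pos, step]
  exact add_pos_of_nonneg_of_pos (mul_nonneg (sub_pos.2 (hb z)).le ((key k).1 z))
    (Finset.sum_pos' (exchange_nonneg (key k).1 z)
      ⟨y, (G.mem_neighborFinset z y).2 hzy, mul_pos (hc z y hzy) (key k).2⟩)
end
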